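/- Let Q : ℝ^3 → (0,∞) be continuous with Q(x) ≤ C⟨x⟩^{-4} and let Q be a fixed point Q = (√(−Δ)+1)^{-1}[(|x|^{-1}∗Q^2)Q]. If Q is radial with Fourier transform Q̂ positive, radial and strictly decreasing in |ξ|, then Q(|x|) is strictly decreasing in |x|. (A radial function whose Fourier transform is positive radial decreasing is itself radially decreasing as a consequence of the representation by decreasing rearrangement-compatible kernels.) -/

import Mathlib

open MeasureTheory Real
open scoped FourierTransform

def sqrtLapl (u g : EuclideanSpace ℝ (Fin 3) → ℝ) : Prop :=
  ∀ ξ, 𝓕 (fun x => (g x : ℂ)) ξ = (2 * π * ‖ξ‖ : ℝ) * 𝓕 (fun x => (u x : ℂ)) ξ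

open Filter Topology Set
open scoped ENNReal RealInnerProductSpace

section Stieltjes

lemma integrable_inv_one_add_sq_mul {β : ℝ} :
    Integrable (fun r : ℝ => r ^ 2 / ((1 + r ^ 2) * (r ^ 2 + β ^ 2))) := by
  refine integrable_inv_one_add_sq.mono' (Measurable.aestronglyMeasurable (by fun_prop))
    (.of_forall fun r => ?_)
  rw [norm_of_nonneg (by positivity), div_mul_eq_div_div_swap, div_eq_mul_inv]
  exact mul_le_of_le_one_left (by positivity)
    (div_le_one_of_le₀ (by nlinarith [sq_nonneg β]) (by positivity))

lemma integral_univ_inv_sq_add_sq {β : ℝ} (hβ : 0 < β) :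
    ∫ r : ℝ, (r ^ 2 + β ^ 2)⁻¹ = π / β := by
  have h := Measure.integral_comp_mul_left (fun r : ℝ => (1 + r ^ 2)⁻¹) β⁻¹
  rw [integral_univ_inv_one_add_sq, inv_inv, abs_of_pos hβ, smul_eq_mul] at h
  have h2 : ∀ r : ℝ, (r ^ 2 + β ^ 2)⁻¹ = (β ^ 2)⁻¹ * (1 + (β⁻¹ * r) ^ 2)⁻¹ := fun r => by
    field_simp
    ring
  simp_rw [h2, integral_const_mul, h]
  field_simp

lemma integral_sq_div_one_add_sq_sq :
    ∫ r : ℝ, r ^ 2 / ((1 + r ^ 2) * (r ^ 2 + 1 ^ 2)) = π / 2 := by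
  have hlim (l : Filter ℝ) (hl : Tendsto (fun r : ℝ => |r|) l atTop) :
      Tendsto (fun r : ℝ => r / (1 + r ^ 2)) l (𝓝 0) := by
    refine squeeze_zero_norm' ?_ (tendsto_inv_atTop_zero.comp hl)
    filter_upwards [hl.eventually_gt_atTop 0] with r hr
    rw [norm_div, norm_of_nonneg (by positivity : (0 : ℝ) ≤ 1 + r ^ 2), norm_eq_abs,
      Function.comp_apply, inv_eq_one_div, div_le_div_iff₀ (by positivity) hr, ← sq, sq_abs]
    linarith
  have h := integral_of_hasDerivAt_of_tendsto (f := fun r : ℝ => (arctan r - r / (1 + r ^ 2)) / 2)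
    (f' := fun r : ℝ => r ^ 2 / ((1 + r ^ 2) * (r ^ 2 + 1 ^ 2))) (m := (-(π / 2) - 0) / 2)
    (n := (π / 2 - 0) / 2) ?_ integrable_inv_one_add_sq_mul ?_ ?_
  · rw [h]; ring
  · intro r
    have hr : (1 + r ^ 2) ≠ 0 := by positivity
    convert! ((hasDerivAt_arctan r).sub ((hasDerivAt_id r).div
      (((hasDerivAt_id r).pow 2).const_add 1) hr)).div_const 2 using 1
    have hr' : r ^ 2 + 1 ≠ 0 := by positivity
    simp
    field_simp
    ring
  · exact (((tendsto_arctan_atBot.mono_right nhdsWithin_le_nhds).sub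
      (hlim _ tendsto_abs_atBot_atTop)).div_const 2)
  · exact (((tendsto_arctan_atTop.mono_right nhdsWithin_le_nhds).sub
      (hlim _ tendsto_abs_atTop_atTop)).div_const 2)

/-- The Stieltjes representation of `β ↦ 1 / (1 + β)` as a function of `β ^ 2`. -/
lemma integral_sq_div_one_add_sq_mul {β : ℝ} (hβ : 0 ≤ β) :
    ∫ r : ℝ, r ^ 2 / ((1 + r ^ 2) * (r ^ 2 + β ^ 2)) = π / (1 + β) := by
  rcases hβ.eq_or_lt with rfl | hβ
  · rw [add_zero, div_one, ← integral_univ_inv_one_add_sq]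
    refine integral_congr_ae ?_
    filter_upwards [Measure.ae_ne volume (0 : ℝ)] with r hr
    field_simp
    simp
  by_cases h1 : β = 1
  · rw [h1, integral_sq_div_one_add_sq_sq]
    norm_num
  have hβ1 : β ^ 2 - 1 ≠ 0 := by
    intro h
    exact h1 (by nlinarith)
  have hi : Integrable fun r : ℝ => (r ^ 2 + β ^ 2)⁻¹ := by
    refine .of_integral_ne_zero ?_
    rw [integral_univ_inv_sq_add_sq hβ]
    positivity
  have : ∀ r : ℝ, r ^ 2 / ((1 + r ^ 2) * (r ^ 2 + β ^ 2)) =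
      (β ^ 2 - 1)⁻¹ * (β ^ 2 * (r ^ 2 + β ^ 2)⁻¹ - (1 + r ^ 2)⁻¹) := fun r => by
    field_simp
    ring
  simp_rw [this]
  rw [integral_const_mul, integral_sub (hi.const_mul _) integrable_inv_one_add_sq,
    integral_const_mul, integral_univ_inv_sq_add_sq hβ, integral_univ_inv_one_add_sq]
  have : β ^ 2 - 1 = (β - 1) * (1 + β) := by ring
  rw [this] at hβ1 ⊢
  have := left_ne_zero_of_mul hβ1
  field_simp

end Stieltjes

section Kernel

variable {E : Type*} [NormedAddCommGroup E] [InnerProductSpace ℝ E]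

/-- The heat kernel at time `s`, whose characteristic function is `exp (-s ‖t‖²)`. -/
noncomputable def heatDensity (s : ℝ) (x : E) : ℝ :=
  ((π / (4 * s)⁻¹) ^ (Module.finrank ℝ E / 2 : ℝ))⁻¹ * rexp (-(4 * s)⁻¹ * ‖x‖ ^ 2)

/-- The weight of the heat kernel at time `p.2` in the resolvent `(√(-Δ) + 1)⁻¹`. -/
noncomputable def resolventWeight (p : ℝ × ℝ) : ℝ :=
  π⁻¹ * (p.1 ^ 2 / (1 + p.1 ^ 2)) * rexp (-p.1 ^ 2 * p.2)

noncomputable def resolventParam : Measure (ℝ × ℝ) := volume.prod (volume.restrict (Ioi 0))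

instance : SFinite resolventParam := by unfold resolventParam; infer_instance

/-- The convolution kernel of `(√(-Δ) + 1)⁻¹`, as a superposition of heat kernels. -/
noncomputable def resolventKernel (x : E) : ℝ≥0∞ :=
  ∫⁻ p, ENNReal.ofReal (resolventWeight p * heatDensity p.2 x) ∂resolventParam

lemma heatDensity_pos {s : ℝ} (hs : 0 < s) (x : E) : 0 < heatDensity s x := by
  unfold heatDensity
  positivity

lemma heatDensity_lt {s : ℝ} (hs : 0 < s) {x y : E} (h : ‖x‖ < ‖y‖) :
    heatDensity s y < heatDensity s x := by
  unfold heatDensity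
  have : 0 < (4 * s)⁻¹ := by positivity
  have h2 : ‖x‖ ^ 2 < ‖y‖ ^ 2 := by gcongr
  gcongr ?_ * rexp ?_
  nlinarith

lemma resolventWeight_nonneg (p : ℝ × ℝ) : 0 ≤ resolventWeight p := by
  unfold resolventWeight
  positivity

lemma resolventWeight_pos {p : ℝ × ℝ} (hp : p.1 ≠ 0) : 0 < resolventWeight p := by
  unfold resolventWeight
  positivity

lemma measurable_resolventWeight : Measurable resolventWeight := by
  unfold resolventWeight
  fun_prop

lemma ae_resolventParam : ∀ᵐ p ∂resolventParam, p.1 ≠ 0 ∧ 0 < p.2 := by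
  have h1 := (Measure.quasiMeasurePreserving_fst (μ := (volume : Measure ℝ))
    (ν := volume.restrict (Ioi (0 : ℝ)))).ae (Measure.ae_ne volume (0 : ℝ))
  have h2 := (Measure.quasiMeasurePreserving_snd (μ := (volume : Measure ℝ))
    (ν := volume.restrict (Ioi (0 : ℝ)))).ae (ae_restrict_mem measurableSet_Ioi)
  filter_upwards [h1, h2] with p hp1 hp2 using ⟨hp1, hp2⟩

variable [MeasurableSpace E] [BorelSpace E]

lemma measurable_heatDensity : Measurable fun q : ℝ × E => heatDensity q.1 q.2 := by
  unfold heatDensity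
  fun_prop

lemma measurable_resolventDensity :
    Measurable fun q : (ℝ × ℝ) × E => resolventWeight q.1 * heatDensity q.1.2 q.2 :=
  (measurable_resolventWeight.comp measurable_fst).mul
    (measurable_heatDensity.comp (by fun_prop : Measurable fun q : (ℝ × ℝ) × E => (q.1.2, q.2)))

lemma measurable_resolventKernel : Measurable (resolventKernel : E → ℝ≥0∞) := by
  have := (measurable_resolventDensity (E := E)).comp measurable_swap
  exact this.ennreal_ofReal.lintegral_prod_right'

variable [FiniteDimensional ℝ E]

lemma integral_cexp_mul_heatDensity {s : ℝ} (hs : 0 < s) (t : E) :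
    ∫ x : E, Complex.exp (⟪x, t⟫ * Complex.I) * heatDensity s x = rexp (-‖t‖ ^ 2 * s) := by
  have h := GaussianFourier.integral_cexp_neg_mul_sq_norm_add (V := E) (b := ((4 * s)⁻¹ : ℝ))
    (by rw [Complex.ofReal_re]; positivity) Complex.I t
  have hN : (0 : ℝ) < (π / (4 * s)⁻¹) ^ (Module.finrank ℝ E / 2 : ℝ) := by positivity
  have h2 : ((π : ℂ) / ((4 * s)⁻¹ : ℝ)) ^ ((Module.finrank ℝ E : ℂ) / 2) =
      ((π / (4 * s)⁻¹) ^ (Module.finrank ℝ E / 2 : ℝ) : ℝ) := by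
    rw [Complex.ofReal_cpow (by positivity)]
    push_cast
    rfl
  rw [h2] at h
  have h3 : ∀ x : E, Complex.exp (⟪x, t⟫ * Complex.I) * heatDensity s x =
      (((π / (4 * s)⁻¹) ^ (Module.finrank ℝ E / 2 : ℝ))⁻¹ : ℝ) *
      Complex.exp (-((4 * s)⁻¹ : ℝ) * (‖x‖ : ℂ) ^ 2 + Complex.I * ((inner ℝ t x : ℝ) : ℂ)) := by
    intro x
    rw [Complex.exp_add, real_inner_comm, heatDensity]
    push_cast
    ring_nf
  simp_rw [h3, integral_const_mul, h]
  rw [← mul_assoc, ← Complex.ofReal_mul, inv_mul_cancel₀ hN.ne', Complex.ofReal_one, one_mul,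
    Complex.I_sq]
  push_cast
  congr 1
  field_simp

lemma integral_heatDensity {s : ℝ} (hs : 0 < s) : ∫ x : E, heatDensity s x = 1 := by
  unfold heatDensity
  rw [integral_const_mul, GaussianFourier.integral_rexp_neg_mul_sq_norm (by positivity),
    inv_mul_cancel₀ (by positivity)]

lemma lintegral_heatDensity {s : ℝ} (hs : 0 < s) :
    ∫⁻ x : E, ENNReal.ofReal (heatDensity s x) = 1 := by
  rw [← ofReal_integral_eq_lintegral_ofReal, integral_heatDensity hs, ENNReal.ofReal_one]
  · refine .of_integral_ne_zero ?_
    rw [integral_heatDensity hs]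
    exact one_ne_zero
  · exact .of_forall fun x => (heatDensity_pos hs x).le

lemma integral_resolventWeight_mul_exp (r : ℝ) {β : ℝ} (hr : r ≠ 0) :
    ∫ s in Ioi 0, resolventWeight (r, s) * rexp (-β ^ 2 * s) =
      π⁻¹ * (r ^ 2 / ((1 + r ^ 2) * (r ^ 2 + β ^ 2))) := by
  have h : 0 < r ^ 2 + β ^ 2 := by positivity
  have h2 : ∀ s, resolventWeight (r, s) * rexp (-β ^ 2 * s) =
      π⁻¹ * (r ^ 2 / (1 + r ^ 2)) * rexp (-(r ^ 2 + β ^ 2) * s) := fun s => by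
    rw [resolventWeight, mul_assoc, ← Real.exp_add]
    ring_nf
  simp_rw [h2]
  rw [integral_const_mul, integral_exp_mul_Ioi (by linarith)]
  simp only [mul_zero, Real.exp_zero]
  field_simp

lemma lintegral_resolventWeight : ∫⁻ p, ENNReal.ofReal (resolventWeight p) ∂resolventParam = 1 := by
  rw [resolventParam, lintegral_prod _ measurable_resolventWeight.ennreal_ofReal.aemeasurable]
  have h1 : ∀ r : ℝ, r ≠ 0 → ∫⁻ s in Ioi 0, ENNReal.ofReal (resolventWeight (r, s)) =
      ENNReal.ofReal (π⁻¹ * (1 + r ^ 2)⁻¹) := fun r hr => by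
    have h := integral_resolventWeight_mul_exp r (β := 0) hr
    have h2 : r ^ 2 / ((1 + r ^ 2) * (r ^ 2 + 0 ^ 2)) = (1 + r ^ 2)⁻¹ := by
      field_simp
      simp
    simp only [h2] at h
    simp only [ne_eq, OfNat.ofNat_ne_zero, not_false_eq_true, zero_pow, neg_zero, zero_mul,
      Real.exp_zero, mul_one] at h
    rw [← h, ofReal_integral_eq_lintegral_ofReal]
    · refine .of_integral_ne_zero ?_
      rw [h]
      positivity
    · exact .of_forall fun s => resolventWeight_nonneg _
  have h2 : (fun r : ℝ => ∫⁻ s in Ioi 0, ENNReal.ofReal (resolventWeight (r, s))) =ᵐ[volume]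
      fun r => ENNReal.ofReal (π⁻¹ * (1 + r ^ 2)⁻¹) := by
    filter_upwards [Measure.ae_ne volume (0 : ℝ)] with r hr using h1 r hr
  rw [lintegral_congr_ae h2, ← ofReal_integral_eq_lintegral_ofReal, integral_const_mul,
    integral_univ_inv_one_add_sq, inv_mul_cancel₀ pi_ne_zero, ENNReal.ofReal_one]
  · exact integrable_inv_one_add_sq.const_mul _
  · exact .of_forall fun r => by positivity

lemma integral_resolventWeight_mul_exp_param {β : ℝ} (hβ : 0 ≤ β) :
    ∫ p, resolventWeight p * rexp (-β ^ 2 * p.2) ∂resolventParam = (1 + β)⁻¹ := by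
  have hi : Integrable (fun p => resolventWeight p * rexp (-β ^ 2 * p.2)) resolventParam := by
    have h : Integrable resolventWeight resolventParam := by
      refine ⟨measurable_resolventWeight.aestronglyMeasurable, ?_⟩
      rw [hasFiniteIntegral_iff_ofReal (.of_forall resolventWeight_nonneg),
        lintegral_resolventWeight]
      exact ENNReal.one_lt_top
    refine h.mono' (measurable_resolventWeight.mul (by fun_prop)).aestronglyMeasurable ?_
    filter_upwards [ae_resolventParam] with p hp
    rw [norm_of_nonneg (mul_nonneg (resolventWeight_nonneg p) (exp_pos _).le)]
    refine mul_le_of_le_one_right (resolventWeight_nonneg p) (Real.exp_le_one_iff.2 ?_)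
    nlinarith [sq_nonneg β, hp.2, mul_nonneg (sq_nonneg β) hp.2.le]
  rw [resolventParam] at hi ⊢
  rw [integral_prod _ hi]
  have h2 : (fun r : ℝ => ∫ s in Ioi 0, resolventWeight (r, s) * rexp (-β ^ 2 * s)) =ᵐ[volume]
      fun r => π⁻¹ * (r ^ 2 / ((1 + r ^ 2) * (r ^ 2 + β ^ 2))) := by
    filter_upwards [Measure.ae_ne volume (0 : ℝ)] with r hr using
      integral_resolventWeight_mul_exp r hr
  rw [integral_congr_ae h2, integral_const_mul, integral_sq_div_one_add_sq_mul hβ]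
  field_simp

lemma lintegral_resolventDensity :
    ∫⁻ p, (∫⁻ x : E, ENNReal.ofReal (resolventWeight p * heatDensity p.2 x)) ∂resolventParam =
      1 := by
  rw [← lintegral_resolventWeight]
  refine lintegral_congr_ae ?_
  filter_upwards [ae_resolventParam] with p hp
  simp_rw [ENNReal.ofReal_mul (resolventWeight_nonneg p)]
  rw [lintegral_const_mul', lintegral_heatDensity hp.2, mul_one]
  exact ENNReal.ofReal_ne_top

lemma lintegral_resolventKernel : ∫⁻ x : E, resolventKernel x = 1 := by
  rw [← lintegral_resolventDensity (E := E), lintegral_lintegral_swap]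
  · rfl
  · exact measurable_resolventDensity.ennreal_ofReal.aemeasurable

instance : IsFiniteMeasure ((volume : Measure E).withDensity resolventKernel) :=
  isFiniteMeasure_withDensity (by simp [lintegral_resolventKernel])

lemma charFun_resolventKernel (t : E) :
    charFun (volume.withDensity resolventKernel) t = ((1 + ‖t‖)⁻¹ : ℝ) := by
  have hm := measurable_resolventDensity (E := E)
  have hk : ∀ x : E, (resolventKernel x).toReal =
      ∫ p, resolventWeight p * heatDensity p.2 x ∂resolventParam := by
    intro x
    rw [integral_eq_lintegral_of_nonneg_ae]
    · rfl
    · filter_upwards [ae_resolventParam] with p hp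
      exact mul_nonneg (resolventWeight_nonneg p) (heatDensity_pos hp.2 x).le
    · exact (hm.comp (by fun_prop : Measurable fun p : ℝ × ℝ => (p, x))).aestronglyMeasurable
  have hmul : ∀ x : E, (resolventKernel x).toReal • Complex.exp (⟪x, t⟫ * Complex.I) =
      ∫ p, Complex.exp (⟪x, t⟫ * Complex.I) *
        ((resolventWeight p * heatDensity p.2 x : ℝ) : ℂ) ∂resolventParam := by
    intro x
    rw [hk, integral_const_mul, integral_complex_ofReal, Complex.real_smul, mul_comm]
  rw [charFun_apply, integral_withDensity_eq_integral_toReal_smul measurable_resolventKernel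
    (ae_lt_top measurable_resolventKernel (by simp [lintegral_resolventKernel]))]
  simp_rw [hmul]
  rw [integral_integral_swap, ← integral_resolventWeight_mul_exp_param (norm_nonneg t),
    ← integral_complex_ofReal]
  · refine integral_congr_ae ?_
    filter_upwards [ae_resolventParam] with p hp
    rw [Complex.ofReal_mul, ← integral_cexp_mul_heatDensity hp.2 t, ← integral_const_mul]
    congr with x
    push_cast
    ring
  · have hm' : Measurable fun q : E × ℝ × ℝ => resolventWeight q.2 * heatDensity q.2.2 q.1 :=
      hm.comp measurable_swap
    refine ⟨(Measurable.mul (by fun_prop) hm'.complex_ofReal).aestronglyMeasurable, ?_⟩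
    rw [hasFiniteIntegral_iff_enorm]
    have hn : ∀ᵐ q : E × ℝ × ℝ ∂(volume.prod resolventParam),
        ‖Function.uncurry (fun (x : E) p => Complex.exp (⟪x, t⟫ * Complex.I) *
          ((resolventWeight p * heatDensity p.2 x : ℝ) : ℂ)) q‖ₑ =
        ENNReal.ofReal (resolventWeight q.2 * heatDensity q.2.2 q.1) := by
      filter_upwards [Measure.quasiMeasurePreserving_snd.ae ae_resolventParam] with q hq
      rw [Function.uncurry, enorm_mul, ← ofReal_norm, Complex.norm_exp_ofReal_mul_I,
        ENNReal.ofReal_one, one_mul, ← ofReal_norm, Complex.norm_real, norm_of_nonneg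
        (mul_nonneg (resolventWeight_nonneg q.2) (heatDensity_pos hq.2 q.1).le)]
    rw [lintegral_congr_ae hn, lintegral_prod _ hm'.ennreal_ofReal.aemeasurable]
    exact (lintegral_resolventKernel (E := E)).trans_lt ENNReal.one_lt_top

end Kernel

section HalfSpace

variable {E : Type*} [NormedAddCommGroup E] [InnerProductSpace ℝ E]

/-- The reflection across the hyperplane `⟪y, e⟫ = l`, for a unit vector `e`. -/
noncomputable def hyperplaneReflection (e : E) (l : ℝ) (y : E) : E := y - (2 * (⟪y, e⟫ - l)) • e

lemma inner_hyperplaneReflection {e : E} (he : ‖e‖ = 1) (l : ℝ) (y : E) :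
    ⟪hyperplaneReflection e l y, e⟫ = 2 * l - ⟪y, e⟫ := by
  rw [hyperplaneReflection, inner_sub_left, real_inner_smul_left, real_inner_self_eq_norm_sq, he]
  ring

lemma hyperplaneReflection_involutive {e : E} (he : ‖e‖ = 1) (l : ℝ) :
    Function.Involutive (hyperplaneReflection e l) := fun y => by
  conv_lhs => rw [hyperplaneReflection, inner_hyperplaneReflection he]
  rw [hyperplaneReflection]
  module

lemma norm_sub_hyperplaneReflection_sq {e : E} (he : ‖e‖ = 1) (l : ℝ) (x y : E) :
    ‖x - hyperplaneReflection e l y‖ ^ 2 =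
      ‖x - y‖ ^ 2 + 4 * (⟪x, e⟫ - l) * (⟪y, e⟫ - l) := by
  have : x - hyperplaneReflection e l y = (x - y) + (2 * (⟪y, e⟫ - l)) • e := by
    rw [hyperplaneReflection]
    abel
  rw [this, norm_add_sq_real, norm_smul, he, real_inner_smul_right, inner_sub_left, norm_eq_abs,
    mul_one, sq_abs]
  ring

lemma norm_sub_hyperplaneReflection_comm {e : E} (he : ‖e‖ = 1) (l : ℝ) (x y : E) :
    ‖x - hyperplaneReflection e l y‖ = ‖hyperplaneReflection e l x - y‖ := by
  rw [← sq_eq_sq₀ (norm_nonneg _) (norm_nonneg _), norm_sub_rev (hyperplaneReflection e l x),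
    norm_sub_hyperplaneReflection_sq he, norm_sub_hyperplaneReflection_sq he, norm_sub_rev x]
  ring

lemma norm_hyperplaneReflection_sub {e : E} (he : ‖e‖ = 1) (l : ℝ) (x y : E) :
    ‖hyperplaneReflection e l x - hyperplaneReflection e l y‖ = ‖x - y‖ := by
  rw [norm_sub_hyperplaneReflection_comm he, hyperplaneReflection_involutive he]

lemma norm_sub_lt_norm_sub_hyperplaneReflection {e : E} (he : ‖e‖ = 1) {l : ℝ} {x y : E}
    (hx : l < ⟪x, e⟫) (hy : l < ⟪y, e⟫) : ‖x - y‖ < ‖x - hyperplaneReflection e l y‖ := by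
  refine lt_of_pow_lt_pow_left₀ 2 (norm_nonneg _) ?_
  rw [norm_sub_hyperplaneReflection_sq he]
  nlinarith [mul_pos (sub_pos.2 hx) (sub_pos.2 hy)]

lemma norm_hyperplaneReflection_lt {e : E} (he : ‖e‖ = 1) {l : ℝ} (hl : 0 < l) {y : E}
    (hy : l < ⟪y, e⟫) : ‖hyperplaneReflection e l y‖ < ‖y‖ := by
  refine lt_of_pow_lt_pow_left₀ 2 (norm_nonneg _) ?_
  have h := norm_sub_hyperplaneReflection_sq he l 0 y
  rw [zero_sub, zero_sub, norm_neg, norm_neg, inner_zero_left] at h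
  nlinarith [mul_pos hl (sub_pos.2 hy)]

lemma continuous_hyperplaneReflection (e : E) (l : ℝ) : Continuous (hyperplaneReflection e l) := by
  unfold hyperplaneReflection
  fun_prop

lemma hyperplaneReflection_smul {e : E} (he : ‖e‖ = 1) (l a : ℝ) :
    hyperplaneReflection e l (a • e) = (2 * l - a) • e := by
  rw [hyperplaneReflection, real_inner_smul_left, real_inner_self_eq_norm_sq, he]
  module

variable [MeasurableSpace E] [BorelSpace E]

lemma measurableSet_halfSpace (e : E) (l : ℝ) : MeasurableSet {y : E | l < ⟪y, e⟫} :=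
  (isOpen_lt continuous_const (by fun_prop)).measurableSet

variable [FiniteDimensional ℝ E]

lemma measurePreserving_hyperplaneReflection {e : E} (he : ‖e‖ = 1) (l : ℝ) :
    MeasurePreserving (hyperplaneReflection e l) := by
  have h := (measurePreserving_add_right (volume : Measure E) ((2 * l) • e)).comp
    ((ℝ ∙ e)ᗮ.reflection.measurePreserving)
  have heq : hyperplaneReflection e l =
      (fun x => x + (2 * l) • e) ∘ (ℝ ∙ e)ᗮ.reflection := ?_
  · rw [heq]
    exact h
  ext y
  rw [Function.comp_apply, Submodule.reflection_orthogonal_apply,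
    Submodule.reflection_singleton_apply,
    he, real_inner_comm, hyperplaneReflection]
  simp
  module

lemma volume_hyperplane {e : E} (he : ‖e‖ = 1) (l : ℝ) : volume {y : E | ⟪y, e⟫ = l} = 0 := by
  have h := Measure.addHaar_affineSubspace (volume : Measure E)
    (AffineSubspace.mk' (l • e) (ℝ ∙ e)ᗮ) ?_
  · convert h using 2
    ext y
    simp only [mem_ofPred_eq, SetLike.mem_coe, AffineSubspace.mem_mk', vsub_eq_sub,
      Submodule.mem_orthogonal_singleton_iff_inner_left, inner_sub_left, real_inner_smul_left,
      real_inner_self_eq_norm_sq, he]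
    constructor <;> intro h <;> linarith
  · intro h
    have h2 : (l + 1) • e ∈ AffineSubspace.mk' (l • e) (ℝ ∙ e)ᗮ := by rw [h]; trivial
    simp [AffineSubspace.mem_mk', Submodule.mem_orthogonal_singleton_iff_inner_left,
      inner_sub_left, real_inner_smul_left, he] at h2

/-- Folding an integral onto a half-space. -/
lemma lintegral_eq_halfSpace {e : E} (he : ‖e‖ = 1) (l : ℝ) {h : E → ℝ≥0∞} (hh : Measurable h) :
    ∫⁻ y, h y = ∫⁻ y in {y | l < ⟪y, e⟫}, (h y + h (hyperplaneReflection e l y)) := by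
  have hR := measurePreserving_hyperplaneReflection he l
  rw [lintegral_add_left hh, ← lintegral_add_compl h (measurableSet_halfSpace e l)]
  congr 1
  have h1 : ({y | l < ⟪y, e⟫}ᶜ : Set E) =ᵐ[volume]
      (hyperplaneReflection e l ⁻¹' {y | l < ⟪y, e⟫} : Set E) := by
    have h0 : ∀ᵐ y : E, ⟪y, e⟫ ≠ l := by
      rw [ae_iff]
      simpa using volume_hyperplane he l
    filter_upwards [h0] with y hy
    refine propext ?_
    change ¬ l < ⟪y, e⟫ ↔ l < ⟪hyperplaneReflection e l y, e⟫
    rw [inner_hyperplaneReflection he, not_lt]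
    constructor
    · intro h
      have := lt_of_le_of_ne h hy
      linarith
    · intro h
      linarith
  have h2 := hR.setLIntegral_comp_preimage (measurableSet_halfSpace e l)
    (hh.comp hR.measurable)
  simp only [Function.comp_apply, hyperplaneReflection_involutive he l _] at h2
  rw [setLIntegral_congr h1, h2]

end HalfSpace

section Gap

variable {E : Type*} [NormedAddCommGroup E] [InnerProductSpace ℝ E]

lemma heatDensity_congr (s : ℝ) {x y : E} (h : ‖x‖ = ‖y‖) : heatDensity s x = heatDensity s y := by
  unfold heatDensity
  rw [h]

lemma resolventKernel_congr {x y : E} (h : ‖x‖ = ‖y‖) : resolventKernel x = resolventKernel y := by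
  unfold resolventKernel
  simp_rw [fun s : ℝ => heatDensity_congr s h]

/-- The difference `resolventKernel x - resolventKernel y`, for `‖x‖ ≤ ‖y‖`. -/
noncomputable def resolventGap (x y : E) : ℝ≥0∞ :=
  ∫⁻ p, ENNReal.ofReal (resolventWeight p * (heatDensity p.2 x - heatDensity p.2 y)) ∂resolventParam

lemma resolventGap_congr {x y x' y' : E} (h : ‖x‖ = ‖x'‖) (h' : ‖y‖ = ‖y'‖) :
    resolventGap x y = resolventGap x' y' := by
  unfold resolventGap
  simp_rw [fun s : ℝ => heatDensity_congr s h, fun s : ℝ => heatDensity_congr s h']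

lemma resolventParam_ne_zero : resolventParam ≠ 0 := fun h => by
  have := lintegral_resolventWeight
  simp [h] at this

variable [MeasurableSpace E] [BorelSpace E]

lemma measurable_resolventGap : Measurable fun q : E × E => resolventGap q.1 q.2 := by
  have hm := measurable_heatDensity (E := E)
  have h : Measurable fun z : (E × E) × ℝ × ℝ => ENNReal.ofReal
      (resolventWeight z.2 * (heatDensity z.2.2 z.1.1 - heatDensity z.2.2 z.1.2)) :=
    ((measurable_resolventWeight.comp measurable_snd).mul
      ((hm.comp (by fun_prop : Measurable fun z : (E × E) × ℝ × ℝ => (z.2.2, z.1.1))).sub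
      (hm.comp (by fun_prop : Measurable fun z : (E × E) × ℝ × ℝ =>
        (z.2.2, z.1.2))))).ennreal_ofReal
  exact h.lintegral_prod_right'

lemma resolventKernel_pos (x : E) : 0 < resolventKernel x := by
  have hm := (measurable_resolventDensity (E := E)).comp
    (by fun_prop : Measurable fun p : ℝ × ℝ => (p, x))
  have hm' := hm.ennreal_ofReal
  simp only [Function.comp_apply] at hm'
  rw [resolventKernel, lintegral_pos_iff_support hm', pos_iff_ne_zero]
  intro h
  refine resolventParam_ne_zero (Measure.measure_univ_eq_zero.1 (le_antisymm ?_ bot_le))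
  rw [← h]
  refine measure_mono_ae ?_
  filter_upwards [ae_resolventParam] with p hp _
  exact (ENNReal.ofReal_pos.2 (mul_pos (resolventWeight_pos hp.1) (heatDensity_pos hp.2 x))).ne'

lemma resolventGap_pos {x y : E} (h : ‖x‖ < ‖y‖) : 0 < resolventGap x y := by
  have hm : Measurable fun p : ℝ × ℝ =>
      resolventWeight p * (heatDensity p.2 x - heatDensity p.2 y) :=
    measurable_resolventWeight.mul
      ((measurable_heatDensity.comp (by fun_prop : Measurable fun p : ℝ × ℝ => (p.2, x))).sub
      (measurable_heatDensity.comp (by fun_prop : Measurable fun p : ℝ × ℝ => (p.2, y))))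
  rw [resolventGap, lintegral_pos_iff_support hm.ennreal_ofReal, pos_iff_ne_zero]
  intro h0
  refine resolventParam_ne_zero (Measure.measure_univ_eq_zero.1 (le_antisymm ?_ bot_le))
  rw [← h0]
  refine measure_mono_ae ?_
  filter_upwards [ae_resolventParam] with p hp _
  exact (ENNReal.ofReal_pos.2 (mul_pos (resolventWeight_pos hp.1)
    (sub_pos.2 (heatDensity_lt hp.2 h)))).ne'

lemma resolventKernel_eq_add_gap {x y : E} (h : ‖x‖ < ‖y‖) :
    resolventKernel x = resolventKernel y + resolventGap x y := by
  have hm := (measurable_resolventDensity (E := E)).comp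
    (by fun_prop : Measurable fun p : ℝ × ℝ => (p, y))
  have hm' := hm.ennreal_ofReal
  simp only [Function.comp_apply] at hm'
  rw [resolventKernel, resolventKernel, resolventGap, ← lintegral_add_left hm']
  refine lintegral_congr_ae ?_
  filter_upwards [ae_resolventParam] with p hp
  rw [← ENNReal.ofReal_add]
  · ring_nf
  · exact mul_nonneg (resolventWeight_nonneg p) (heatDensity_pos hp.2 y).le
  · exact mul_nonneg (resolventWeight_nonneg p) (sub_pos.2 (heatDensity_lt hp.2 h)).le

end Gap

section Reflection

variable {E : Type*} [NormedAddCommGroup E] [InnerProductSpace ℝ E] [MeasurableSpace E]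
  [BorelSpace E] [FiniteDimensional ℝ E]

lemma measurable_halfSpaceResolvent_kernel (e : E) (l : ℝ) : Measurable fun z : E × E =>
    resolventGap (z.1 - z.2) (z.1 - hyperplaneReflection e l z.2) := by
  have hR := (continuous_hyperplaneReflection e l).measurable
  have h : Measurable fun z : E × E => (z.1 - z.2, z.1 - hyperplaneReflection e l z.2) :=
    (measurable_fst.sub measurable_snd).prodMk (measurable_fst.sub (hR.comp measurable_snd))
  have := measurable_resolventGap.comp h
  exact this

lemma measurable_halfSpaceResolvent_kernel_right (e : E) (l : ℝ) (x : E) : Measurable fun y : E =>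
    resolventGap (x - y) (x - hyperplaneReflection e l y) := by
  have := (measurable_halfSpaceResolvent_kernel e l).comp (measurable_prodMk_left (x := x))
  exact this

/-- The operator on the half-space `{y | l < ⟪y, e⟫}` with the odd reflection of `resolventKernel`
as its kernel. -/
noncomputable def halfSpaceResolvent (e : E) (l : ℝ) (h : E → ℝ≥0∞) (x : E) : ℝ≥0∞ :=
  ∫⁻ y in {y | l < ⟪y, e⟫}, resolventGap (x - y) (x - hyperplaneReflection e l y) * h y

lemma measurable_halfSpaceResolvent (e : E) (l : ℝ) {h : E → ℝ≥0∞} (hh : Measurable h) :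
    Measurable (halfSpaceResolvent e l h) :=
  Measurable.lintegral_prod_right'
    (f := fun z : E × E => resolventGap (z.1 - z.2) (z.1 - hyperplaneReflection e l z.2) * h z.2)
    ((measurable_halfSpaceResolvent_kernel e l).mul (hh.comp measurable_snd))

lemma halfSpaceResolvent_symm {e : E} (he : ‖e‖ = 1) (l : ℝ) {g h : E → ℝ≥0∞} (hg : Measurable g)
    (hh : Measurable h) :
    ∫⁻ x in {y | l < ⟪y, e⟫}, g x * halfSpaceResolvent e l h x =
      ∫⁻ x in {y | l < ⟪y, e⟫}, h x * halfSpaceResolvent e l g x := by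
  have hk := measurable_halfSpaceResolvent_kernel e l
  have hk' := measurable_halfSpaceResolvent_kernel_right e l
  have hmul : ∀ {f : E → ℝ≥0∞} (c : ℝ≥0∞), Measurable f → ∀ x, c * halfSpaceResolvent e l f x =
      ∫⁻ y in {y | l < ⟪y, e⟫},
        c * (resolventGap (x - y) (x - hyperplaneReflection e l y) * f y) :=
    fun c hf x => (lintegral_const_mul c ((hk' x).mul hf)).symm
  simp only [hmul _ hg, hmul _ hh]
  rw [lintegral_lintegral_swap]
  · refine lintegral_congr fun x => lintegral_congr fun y => ?_
    rw [resolventGap_congr (norm_sub_rev y x) ((norm_sub_rev y _).trans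
      (norm_sub_hyperplaneReflection_comm he l x y).symm)]
    ring
  · exact ((hg.comp measurable_fst).mul (hk.mul (hh.comp measurable_snd))).aemeasurable

lemma lconvolution_resolventKernel {e : E} (he : ‖e‖ = 1) (l : ℝ) {f : E → ℝ≥0∞}
    (hf : Measurable f) {x : E} (hx : l < ⟪x, e⟫) :
    (f ⋆ₗ resolventKernel) x = (∫⁻ y in {y | l < ⟪y, e⟫},
      (f y + f (hyperplaneReflection e l y)) * resolventKernel (x - hyperplaneReflection e l y)) +
      halfSpaceResolvent e l f x ∧
    (f ⋆ₗ resolventKernel) (hyperplaneReflection e l x) = (∫⁻ y in {y | l < ⟪y, e⟫},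
      (f y + f (hyperplaneReflection e l y)) * resolventKernel (x - hyperplaneReflection e l y)) +
      halfSpaceResolvent e l (f ∘ hyperplaneReflection e l) x := by
  have hR := (continuous_hyperplaneReflection e l).measurable
  have hk : Measurable (resolventKernel : E → ℝ≥0∞) := measurable_resolventKernel
  have hS : Measurable fun y => (f y + f (hyperplaneReflection e l y)) *
      resolventKernel (x - hyperplaneReflection e l y) := by fun_prop
  constructor
  · rw [lconvolution_def, lintegral_eq_halfSpace he l (by fun_prop), halfSpaceResolvent,
      ← lintegral_add_left hS]
    refine setLIntegral_congr_fun (measurableSet_halfSpace e l) fun y hy => ?_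
    rw [neg_add_eq_sub, neg_add_eq_sub,
      resolventKernel_eq_add_gap (norm_sub_lt_norm_sub_hyperplaneReflection he hx hy)]
    ring
  · rw [lconvolution_def, lintegral_eq_halfSpace he l (by fun_prop), halfSpaceResolvent,
      ← lintegral_add_left hS]
    refine setLIntegral_congr_fun (measurableSet_halfSpace e l) fun y hy => ?_
    simp only [Function.comp_apply]
    rw [neg_add_eq_sub, neg_add_eq_sub,
      resolventKernel_congr (norm_hyperplaneReflection_sub he l x y),
      resolventKernel_congr (norm_sub_hyperplaneReflection_comm he l x y).symm,
      resolventKernel_eq_add_gap (norm_sub_lt_norm_sub_hyperplaneReflection he hx hy)]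
    ring

/-- A positive solution `q` of `q = (√(-Δ) + 1)⁻¹ (v q)` with a strictly radially decreasing
potential `v` is larger at the reflection of a point that is closer to the origin. -/
theorem ae_lt_hyperplaneReflection {e : E} (he : ‖e‖ = 1) {l : ℝ} (hl : 0 < l)
    {q v : E → ℝ≥0∞} (hq : Measurable q) (hv : Measurable v) {M N : ℝ≥0∞} (hM : M ≠ ∞)
    (hN : N ≠ ∞) (hqN : ∀ x, q x ≤ N) (hq0 : ∀ x, 0 < q x) (hqi : ∫⁻ x, q x ≠ ∞)
    (hvM : ∀ x, v x ≤ M) (hv0 : ∀ x, 0 < v x) (hv_lt : ∀ x y, ‖x‖ < ‖y‖ → v y < v x)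
    (hrep : ∀ᵐ x, q x = ((v * q) ⋆ₗ resolventKernel) x) :
    ∀ᵐ x, l < ⟪x, e⟫ → q x < q (hyperplaneReflection e l x) := by
  set R := hyperplaneReflection e l
  set H : Set E := {y | l < ⟪y, e⟫}
  have hH : MeasurableSet H := measurableSet_halfSpace e l
  have hR := measurePreserving_hyperplaneReflection he l
  have hRm : Measurable R := hR.measurable
  have hf : Measurable (v * q) := hv.mul hq
  have hq_top : ∀ x, q x ≠ ∞ := fun x => ((hqN x).trans_lt hN.lt_top).ne
  have hv_top : ∀ x, v x ≠ ∞ := fun x => ((hvM x).trans_lt hM.lt_top).ne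
  set u : E → ℝ≥0∞ := fun x => q x - q (R x)
  have hu : Measurable u := hq.sub (hq.comp hRm)
  have huq : ∀ x, u x ≤ q x := fun x => tsub_le_self
  set S : E → ℝ≥0∞ := fun x => ∫⁻ y in H, ((v * q) y + (v * q) (R y)) * resolventKernel (x - R y)
  have hk : Measurable (resolventKernel : E → ℝ≥0∞) := measurable_resolventKernel
  have hHne : volume.restrict H ≠ 0 := by
    have hopen : IsOpen H := isOpen_lt continuous_const (by fun_prop)
    rw [Ne, Measure.restrict_eq_zero]
    refine (hopen.measure_pos volume ⟨(l + 1) • e, ?_⟩).ne'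
    change l < ⟪(l + 1) • e, e⟫
    rw [real_inner_smul_left, real_inner_self_eq_norm_sq, he]
    linarith
  have hS0 : ∀ x, 0 < S x := fun x => by
    have : ∫⁻ _ in H, 0 < S x := by
      refine lintegral_strict_mono hHne (Measurable.aemeasurable ?_) (by simp)
        (.of_forall fun y => ?_)
      · fun_prop
      · exact ENNReal.mul_pos (add_pos_of_pos_of_nonneg
          (ENNReal.mul_pos (hv0 y).ne' (hq0 y).ne') zero_le).ne' (resolventKernel_pos _).ne'
    simpa using this
  have hrep' : ∀ᵐ x, x ∈ H → q x = S x + halfSpaceResolvent e l (v * q) x ∧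
      q (R x) = S x + halfSpaceResolvent e l ((v * q) ∘ R) x := by
    filter_upwards [hrep, hR.quasiMeasurePreserving.ae hrep] with x h1 h2 hx
    obtain ⟨h3, h4⟩ := lconvolution_resolventKernel he l hf hx
    exact ⟨h1.trans h3, h2.trans h4⟩
  have hu_le : ∀ᵐ x, x ∈ H → u x ≤ halfSpaceResolvent e l (v * u) x := by
    filter_upwards [hrep'] with x hx hxH
    obtain ⟨h1, h2⟩ := hx hxH
    rw [tsub_le_iff_left, h2, add_assoc, h1]
    gcongr
    unfold halfSpaceResolvent
    rw [← lintegral_add_left]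
    · refine setLIntegral_mono_ae (Measurable.aemeasurable ?_) (.of_forall fun y hy => ?_)
      · have := measurable_halfSpaceResolvent_kernel_right e l x
        exact (this.mul (hf.comp hRm)).add (this.mul (hv.mul hu))
      · rw [← mul_add]
        gcongr
        calc (v * q) y ≤ v y * (q (R y) + u y) := by
              rw [Pi.mul_apply]
              gcongr
              exact le_add_tsub
          _ = v y * q (R y) + v y * u y := mul_add _ _ _
          _ ≤ _ := by
              simp only [Function.comp_apply, Pi.mul_apply]
              gcongr
              exact (hv_lt _ _ (norm_hyperplaneReflection_lt he hl hy)).le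
    · have := measurable_halfSpaceResolvent_kernel_right e l x
      exact this.mul (hf.comp hRm)
  have hT_lt : ∀ᵐ x, x ∈ H → halfSpaceResolvent e l (v * q) x < q x := by
    filter_upwards [hrep'] with x hx hxH
    obtain ⟨h1, -⟩ := hx hxH
    rw [h1, add_comm]
    refine ENNReal.lt_add_right (fun h => hq_top x ?_) (hS0 x).ne'
    rw [h1, h, add_top]
  have hfin : ∫⁻ x in H, (v * u) x * q x ≠ ∞ := by
    refine ne_top_of_le_ne_top (ENNReal.mul_ne_top (ENNReal.mul_ne_top hM hN) hqi) ?_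
    rw [← lintegral_const_mul _ hq]
    refine (setLIntegral_le_lintegral _ _).trans (lintegral_mono fun x => ?_)
    rw [Pi.mul_apply]
    gcongr
    · exact hvM x
    · exact (huq x).trans (hqN x)
  have hle : ∫⁻ x in H, (v * u) x * q x ≤
      ∫⁻ x in H, (v * u) x * halfSpaceResolvent e l (v * q) x := by
    rw [halfSpaceResolvent_symm he l (hv.mul hu) hf]
    refine setLIntegral_mono_ae
      (hf.mul (measurable_halfSpaceResolvent e l (hv.mul hu))).aemeasurable ?_
    filter_upwards [hu_le] with x hx hxH
    calc (v * u) x * q x = (v * q) x * u x := by simp only [Pi.mul_apply]; ring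
      _ ≤ _ := by gcongr; exact hx hxH
  have hge : (fun x => (v * u) x * halfSpaceResolvent e l (v * q) x) ≤ᵐ[volume.restrict H]
      fun x => (v * u) x * q x := by
    rw [EventuallyLE, ae_restrict_iff' hH]
    filter_upwards [hT_lt] with x hx hxH
    gcongr
    exact (hx hxH).le
  have heq := ae_eq_of_ae_le_of_lintegral_le hge
    (ne_top_of_le_ne_top hfin (lintegral_mono_ae hge)) ((hv.mul hu).mul hq).aemeasurable hle
  rw [EventuallyEq, ae_restrict_iff' hH] at heq
  have hf_lt : ∀ᵐ y, y ∈ H → (v * q) y < ((v * q) ∘ R) y := by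
    filter_upwards [heq, hT_lt] with y hy1 hy2 hyH
    have hvu : (v * u) y = 0 := by
      by_contra h0
      refine (hy2 hyH).ne ((ENNReal.mul_right_inj h0 ?_).1 (hy1 hyH))
      exact ENNReal.mul_ne_top (hv_top y) (ne_top_of_le_ne_top (hq_top y) (huq y))
    have hu0 : u y = 0 := (mul_eq_zero.1 hvu).resolve_left (hv0 y).ne'
    have hqle : q y ≤ q (R y) := tsub_eq_zero_iff_le.1 hu0
    calc v y * q y < v (R y) * q y := by
          exact (ENNReal.mul_lt_mul_iff_left (hq0 y).ne' (hq_top y)).2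
            (hv_lt _ _ (norm_hyperplaneReflection_lt he hl hyH))
      _ ≤ _ := by
          simp only [Function.comp_apply, Pi.mul_apply]
          gcongr
  filter_upwards [hrep', hT_lt] with x hx hxT hxH
  obtain ⟨h1, h2⟩ := hx hxH
  have hTtop : halfSpaceResolvent e l (v * q) x ≠ ∞ := ((hxT hxH).trans_le le_top).ne
  rw [h1, h2]
  have hStop : S x ≠ ∞ := fun h => hq_top x (by rw [h1, h, top_add])
  refine ENNReal.add_lt_add_left hStop ?_
  have hgm : Measurable fun y => resolventGap (x - y) (x - R y) :=
    measurable_halfSpaceResolvent_kernel_right e l x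
  have hgap : ∀ᵐ y ∂volume.restrict H, resolventGap (x - y) (x - R y) * (v * q) y < ∞ :=
    ae_lt_top (hgm.mul hf) hTtop
  refine lintegral_strict_mono hHne (hgm.mul (hf.comp hRm)).aemeasurable hTtop ?_
  filter_upwards [hgap, ae_restrict_mem hH, (ae_restrict_iff' hH).2 hf_lt] with y hy hyH hylt
  have hg0 := (resolventGap_pos (norm_sub_lt_norm_sub_hyperplaneReflection he hxH hyH)).ne'
  refine (ENNReal.mul_lt_mul_iff_right hg0 fun htop => ?_).2 hylt
  rw [htop, Pi.mul_apply, ENNReal.top_mul (ENNReal.mul_pos (hv0 y).ne' (hq0 y).ne').ne'] at hy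
  exact lt_irrefl _ hy

end Reflection

section Monotone

variable {E : Type*} [NormedAddCommGroup E] [InnerProductSpace ℝ E] [MeasurableSpace E]
  [BorelSpace E] [FiniteDimensional ℝ E]

lemma le_of_ae_lt_hyperplaneReflection {e : E} (he : ‖e‖ = 1) {f : E → ℝ} (hf : Continuous f)
    (hrad : ∀ x y, ‖x‖ = ‖y‖ → f x = f y)
    (h : ∀ l, 0 < l → ∀ᵐ y, l < ⟪y, e⟫ → f y < f (hyperplaneReflection e l y)) {x y : E}
    (hxy : ‖x‖ < ‖y‖) : f y ≤ f x := by
  set a := ‖x‖ with ha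
  set b := ‖y‖ with hb
  have ha0 : 0 ≤ a := norm_nonneg x
  set l := (a + b) / 2 with hl
  rw [hrad x (a • e) (by simp [norm_smul, he, ha]), hrad y (b • e) (by simp [norm_smul, he, hb])]
  by_contra! hlt
  have hopen : IsOpen {z | l < ⟪z, e⟫ ∧ f (hyperplaneReflection e l z) < f z} :=
    (isOpen_lt continuous_const (continuous_id.inner continuous_const)).and
      (isOpen_lt (hf.comp (continuous_hyperplaneReflection e l)) hf)
  have hmem : b • e ∈ {z | l < ⟪z, e⟫ ∧ f (hyperplaneReflection e l z) < f z} := by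
    refine ⟨?_, ?_⟩
    · rw [real_inner_smul_left, real_inner_self_eq_norm_sq, he]
      linarith
    · rwa [hyperplaneReflection_smul he, show 2 * l - b = a by linarith]
  obtain ⟨z, hz, hz'⟩ := (Measure.dense_of_ae (h l (by linarith))).inter_open_nonempty _ hopen
    ⟨_, hmem⟩
  exact (hz' hz.1).not_gt hz.2

/-- A continuous radial function that increases a.e. under reflection towards the origin is
strictly radially decreasing. -/
theorem lt_of_ae_lt_hyperplaneReflection {e : E} (he : ‖e‖ = 1) {f : E → ℝ} (hf : Continuous f)
    (hrad : ∀ x y, ‖x‖ = ‖y‖ → f x = f y)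
    (h : ∀ l, 0 < l → ∀ᵐ y, l < ⟪y, e⟫ → f y < f (hyperplaneReflection e l y)) {x y : E}
    (hxy : ‖x‖ < ‖y‖) : f y < f x := by
  set a := ‖x‖ with ha
  set b := ‖y‖ with hb
  have ha0 : 0 ≤ a := norm_nonneg x
  set l := (a + b) / 2 with hl
  have hopen : IsOpen {z | l < ⟪z, e⟫ ∧ ‖z‖ < b ∧ a < ‖hyperplaneReflection e l z‖} :=
    (isOpen_lt continuous_const (continuous_id.inner continuous_const)).and ((isOpen_lt
      continuous_norm continuous_const).and (isOpen_lt continuous_const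
        (continuous_hyperplaneReflection e l).norm))
  have hmem : (b - (b - a) / 4) • e ∈
      {z | l < ⟪z, e⟫ ∧ ‖z‖ < b ∧ a < ‖hyperplaneReflection e l z‖} := by
    refine ⟨?_, ?_, ?_⟩
    · rw [real_inner_smul_left, real_inner_self_eq_norm_sq, he]
      linarith
    · rw [norm_smul, he, norm_of_nonneg (by linarith)]
      linarith
    · rw [hyperplaneReflection_smul he, norm_smul, he, norm_of_nonneg (by linarith)]
      linarith
  obtain ⟨z, ⟨hz, hzb, hza⟩, hz'⟩ :=
    (Measure.dense_of_ae (h l (by linarith))).inter_open_nonempty _ hopen ⟨_, hmem⟩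
  exact ((le_of_ae_lt_hyperplaneReflection he hf hrad h hzb).trans_lt (hz' hz)).trans_le
    (le_of_ae_lt_hyperplaneReflection he hf hrad h hza)

end Monotone

section Newton

lemma measurePreserving_coordinates : MeasurePreserving
    (fun y : EuclideanSpace ℝ (Fin 3) => (y 0, (y 1, y 2))) := by
  have := ((MeasurePreserving.id volume).prod (volume_preserving_finTwoArrow ℝ)).comp
    ((volume_preserving_piFinSuccAbove (fun _ : Fin 3 => ℝ) 0).comp
      (PiLp.volume_preserving_ofLp (Fin 3)))
  exact this

lemma lintegral_plane_radial {g : ℝ → ℝ≥0∞} (hg : Measurable g) :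
    ∫⁻ p : ℝ × ℝ, g √(p.1 ^ 2 + p.2 ^ 2) =
      ENNReal.ofReal (2 * π) * ∫⁻ r in Ioi (0 : ℝ), ENNReal.ofReal r * g r := by
  rw [← lintegral_comp_polarCoord_symm, polarCoord_target, Measure.volume_eq_prod,
    ← Measure.prod_restrict, lintegral_prod _ (by
      refine Measurable.aemeasurable ?_
      simp only [polarCoord_symm_apply, smul_eq_mul]
      fun_prop), ← lintegral_const_mul _ (by fun_prop)]
  refine setLIntegral_congr_fun measurableSet_Ioi fun r hr => ?_
  have hr : 0 < r := hr
  have h : ∀ φ, √((r * cos φ) ^ 2 + (r * sin φ) ^ 2) = r := fun φ => by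
    rw [show (r * cos φ) ^ 2 + (r * sin φ) ^ 2 = r ^ 2 * (sin φ ^ 2 + cos φ ^ 2) by ring,
      sin_sq_add_cos_sq, mul_one, sqrt_sq hr.le]
  simp only [polarCoord_symm_apply, smul_eq_mul, h, lintegral_const, Measure.restrict_apply_univ,
    Real.volume_Ioo]
  rw [show π - -π = 2 * π by ring, mul_comm]

lemma lintegral_axial {g : ℝ × ℝ → ℝ≥0∞} (hg : Measurable g) :
    ∫⁻ y : EuclideanSpace ℝ (Fin 3), g (y 0, √(y 1 ^ 2 + y 2 ^ 2)) =
      ENNReal.ofReal (2 * π) * ∫⁻ z : ℝ, ∫⁻ r in Ioi (0 : ℝ), ENNReal.ofReal r * g (z, r) := by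
  have hG : Measurable fun p : ℝ × ℝ × ℝ => g (p.1, √(p.2.1 ^ 2 + p.2.2 ^ 2)) := by fun_prop
  rw [measurePreserving_coordinates.lintegral_comp hG, Measure.volume_eq_prod,
    lintegral_prod _ hG.aemeasurable, ← lintegral_const_mul _
      (Measurable.lintegral_prod_right' (f := fun p : ℝ × ℝ => ENNReal.ofReal p.2 * g p)
        (by fun_prop))]
  exact lintegral_congr fun z => lintegral_plane_radial (g := fun r => g (z, r)) (by fun_prop)

lemma lintegral_halfPlane_polar {h : ℝ × ℝ → ℝ≥0∞} (hh : Measurable h) :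
    ∫⁻ z : ℝ, ∫⁻ r in Ioi (0 : ℝ), h (z, r) =
      ∫⁻ s in Ioi (0 : ℝ), ENNReal.ofReal s *
        ∫⁻ φ in Ioo 0 π, h (s * cos φ, s * sin φ) := by
  have hI : Measurable ((univ ×ˢ Ioi (0 : ℝ)).indicator h) :=
    hh.indicator (MeasurableSet.univ.prod measurableSet_Ioi)
  have h1 : ∫⁻ z : ℝ, ∫⁻ r in Ioi (0 : ℝ), h (z, r) =
      ∫⁻ p, (univ ×ˢ Ioi (0 : ℝ)).indicator h p := by
    rw [Measure.volume_eq_prod, lintegral_prod _ hI.aemeasurable]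
    refine lintegral_congr fun z => ?_
    rw [← lintegral_indicator measurableSet_Ioi]
    refine lintegral_congr fun r => ?_
    simp [indicator]
  rw [h1, ← lintegral_comp_polarCoord_symm, polarCoord_target, Measure.volume_eq_prod,
    ← Measure.prod_restrict, lintegral_prod _ (by
      refine Measurable.aemeasurable ?_
      simp only [polarCoord_symm_apply, smul_eq_mul]
      exact (measurable_fst.ennreal_ofReal).mul (hI.comp (by fun_prop)))]
  refine setLIntegral_congr_fun measurableSet_Ioi fun s hs0 => ?_
  have hs0 : 0 < s := hs0
  simp only [polarCoord_symm_apply, smul_eq_mul]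
  have hIs : Measurable fun φ => (univ ×ˢ Ioi (0 : ℝ)).indicator h (s * cos φ, s * sin φ) := by
    fun_prop
  rw [lintegral_const_mul _ hIs]
  congr 1
  rw [← lintegral_indicator measurableSet_Ioo, ← lintegral_indicator measurableSet_Ioo]
  refine lintegral_congr fun φ => ?_
  by_cases h1 : φ ∈ Ioo (-π) π
  · by_cases h2 : 0 < φ
    · have : φ ∈ Ioo 0 π := ⟨h2, h1.2⟩
      simp [indicator, h1.1, h1.2, h2, hs0, sin_pos_of_mem_Ioo this]
    · have : ¬ 0 < s * sin φ := by
        rw [mul_pos_iff_of_pos_left hs0, not_lt]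
        exact sin_nonpos_of_nonpos_of_neg_pi_le (not_lt.1 h2) h1.1.le
      simp [indicator, h1.1, h1.2, h2, this]
  · have : φ ∉ Ioo 0 π := fun h => h1 ⟨by linarith [h.1, pi_pos], h.2⟩
    rw [indicator_of_notMem h1, indicator_of_notMem this]

lemma lintegral_sin_mul_inv_sqrt {a s : ℝ} (ha : 0 ≤ a) (hs : 0 < s) :
    ∫⁻ φ in Ioo 0 π, ENNReal.ofReal (sin φ * (√(a ^ 2 - 2 * a * s * cos φ + s ^ 2))⁻¹) =
      ENNReal.ofReal (2 / max a s) := by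
  have hnn : ∀ φ ∈ Ioo 0 π, 0 ≤ sin φ * (√(a ^ 2 - 2 * a * s * cos φ + s ^ 2))⁻¹ :=
    fun φ hφ => mul_nonneg (sin_pos_of_mem_Ioo hφ).le (by positivity)
  obtain ⟨F, hFc, hF, hFs⟩ : ∃ F : ℝ → ℝ, Continuous F ∧ (∀ φ ∈ Ioo 0 π, HasDerivAt F
      (sin φ * (√(a ^ 2 - 2 * a * s * cos φ + s ^ 2))⁻¹) φ) ∧ F π - F 0 = 2 / max a s := by
    rcases ha.eq_or_lt with rfl | ha
    · refine ⟨fun φ => - cos φ * s⁻¹, by fun_prop, fun φ _ => ?_, ?_⟩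
      · have := ((hasDerivAt_cos φ).neg.mul_const s⁻¹)
        simpa [sqrt_sq hs.le] using this
      · simp [max_eq_right hs.le]
        field_simp
        norm_num
    · refine ⟨fun φ => √(a ^ 2 - 2 * a * s * cos φ + s ^ 2) / (a * s), by fun_prop,
        fun φ hφ => ?_, ?_⟩
      · have hpos : 0 < a ^ 2 - 2 * a * s * cos φ + s ^ 2 := by
          have hc : cos φ < 1 := by
            have := cos_lt_cos_of_nonneg_of_le_pi le_rfl hφ.2.le hφ.1
            simpa using this
          nlinarith [sq_nonneg (a - s), mul_pos (mul_pos ha hs) (sub_pos.2 hc)]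
        have h1 : HasDerivAt (fun φ => a ^ 2 - 2 * a * s * cos φ + s ^ 2)
            (2 * a * s * sin φ) φ := by
          refine ((((hasDerivAt_cos φ).const_mul (2 * a * s)).const_sub (a ^ 2)).add_const
            (s ^ 2)).congr_deriv ?_
          ring
        refine ((h1.sqrt hpos.ne').div_const (a * s)).congr_deriv ?_
        have := sqrt_pos.2 hpos
        field_simp
      · simp only [cos_pi, cos_zero]
        rw [show a ^ 2 - 2 * a * s * -1 + s ^ 2 = (a + s) ^ 2 by ring,
          show a ^ 2 - 2 * a * s * 1 + s ^ 2 = (a - s) ^ 2 by ring, sqrt_sq (by positivity),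
          sqrt_sq_eq_abs]
        rcases le_total a s with h | h
        · rw [max_eq_right h, abs_of_nonpos (by linarith)]
          field_simp
          linarith
        · rw [max_eq_left h, abs_of_nonneg (by linarith)]
          field_simp
          ring
  have hint := intervalIntegral.integrableOn_deriv_of_nonneg hFc.continuousOn hF hnn
  rw [← hFs, ← intervalIntegral.integral_eq_sub_of_hasDerivAt_of_le pi_pos.le hFc.continuousOn hF
    ((intervalIntegrable_iff_integrableOn_Ioc_of_le pi_pos.le).2 hint),
    intervalIntegral.integral_of_le pi_pos.le, integral_Ioc_eq_integral_Ioo,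
    ofReal_integral_eq_lintegral_ofReal (hint.mono_set Ioo_subset_Ioc_self)
    ((ae_restrict_iff' measurableSet_Ioo).2 (.of_forall hnn))]

/-- The Newtonian potential of the radial density `ρ ‖y‖`. -/
noncomputable def newtonPotential (ρ : ℝ → ℝ≥0∞) (x : EuclideanSpace ℝ (Fin 3)) : ℝ≥0∞ :=
  ∫⁻ y, ENNReal.ofReal ‖x - y‖⁻¹ * ρ ‖y‖

lemma measurable_newtonPotential {ρ : ℝ → ℝ≥0∞} (hρ : Measurable ρ) :
    Measurable (newtonPotential ρ) :=
  Measurable.lintegral_prod_right'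
    (f := fun z : EuclideanSpace ℝ (Fin 3) × EuclideanSpace ℝ (Fin 3) =>
      ENNReal.ofReal ‖z.1 - z.2‖⁻¹ * ρ ‖z.2‖) (by fun_prop)

lemma newtonPotential_congr (ρ : ℝ → ℝ≥0∞) {x y : EuclideanSpace ℝ (Fin 3)} (h : ‖x‖ = ‖y‖) :
    newtonPotential ρ x = newtonPotential ρ y := by
  set T := (ℝ ∙ (x - y))ᗮ.reflection
  have hT : T x = y := Submodule.reflection_sub h
  rw [newtonPotential, newtonPotential, ← T.measurePreserving.lintegral_comp_emb
    T.toHomeomorph.measurableEmbedding fun z => ENNReal.ofReal ‖y - z‖⁻¹ * ρ ‖z‖]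
  refine lintegral_congr fun z => ?_
  rw [← hT, ← map_sub, LinearIsometryEquiv.norm_map, LinearIsometryEquiv.norm_map]

/-- **Newton's shell theorem.** -/
lemma newtonPotential_eq {ρ : ℝ → ℝ≥0∞} (hρ : Measurable ρ) (x : EuclideanSpace ℝ (Fin 3)) :
    newtonPotential ρ x = ENNReal.ofReal (4 * π) *
      ∫⁻ s in Ioi (0 : ℝ), ENNReal.ofReal (s ^ 2 / max ‖x‖ s) * ρ s := by
  set a := ‖x‖ with ha
  have hx : newtonPotential ρ x = newtonPotential ρ (EuclideanSpace.single 0 a) :=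
    newtonPotential_congr ρ (by simp [ha])
  set g : ℝ × ℝ → ℝ≥0∞ := fun p =>
    ENNReal.ofReal (√((a - p.1) ^ 2 + p.2 ^ 2))⁻¹ * ρ √(p.1 ^ 2 + p.2 ^ 2) with hg
  have hgm : Measurable g := by fun_prop
  have h1 : newtonPotential ρ (EuclideanSpace.single 0 a) =
      ∫⁻ y : EuclideanSpace ℝ (Fin 3), g (y 0, √(y 1 ^ 2 + y 2 ^ 2)) := by
    refine lintegral_congr fun y => ?_
    simp only [hg]
    have hnn : 0 ≤ y 1 ^ 2 + y 2 ^ 2 := by positivity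
    rw [EuclideanSpace.norm_eq, EuclideanSpace.norm_eq, sq_sqrt hnn]
    simp [Fin.sum_univ_three, add_assoc]
  rw [hx, h1, lintegral_axial hgm, lintegral_halfPlane_polar (h := fun p =>
    ENNReal.ofReal p.2 * g p) (by fun_prop), show 4 * π = 2 * π * 2 by ring,
    ENNReal.ofReal_mul (p := 2 * π) (by positivity), mul_assoc]
  congr 1
  rw [← lintegral_const_mul _ (by fun_prop)]
  refine setLIntegral_congr_fun measurableSet_Ioi fun s hs => ?_
  have hs : 0 < s := hs
  have h2 : ∀ φ ∈ Ioo 0 π, ENNReal.ofReal (s * sin φ) * g (s * cos φ, s * sin φ) =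
      ENNReal.ofReal s * ρ s *
        ENNReal.ofReal (sin φ * (√(a ^ 2 - 2 * a * s * cos φ + s ^ 2))⁻¹) := fun φ hφ => by
    have h3 : (s * cos φ) ^ 2 + (s * sin φ) ^ 2 = s ^ 2 := by
      linear_combination s ^ 2 * sin_sq_add_cos_sq φ
    have h4 : (a - s * cos φ) ^ 2 + (s * sin φ) ^ 2 = a ^ 2 - 2 * a * s * cos φ + s ^ 2 := by
      linear_combination s ^ 2 * sin_sq_add_cos_sq φ
    simp only [hg]
    rw [h3, h4, sqrt_sq hs.le, ENNReal.ofReal_mul hs.le,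
      ENNReal.ofReal_mul (sin_pos_of_mem_Ioo hφ).le]
    ring
  simp only
  rw [setLIntegral_congr_fun measurableSet_Ioo h2, lintegral_const_mul _ (by fun_prop),
    lintegral_sin_mul_inv_sqrt (norm_nonneg x) hs]
  have h5 : ENNReal.ofReal 2 * ENNReal.ofReal (s ^ 2 / max a s) =
      ENNReal.ofReal s * ENNReal.ofReal s * ENNReal.ofReal (2 / max a s) := by
    rw [← ENNReal.ofReal_mul (by norm_num), ← ENNReal.ofReal_mul hs.le,
      ← ENNReal.ofReal_mul (by positivity)]
    congr 1
    ring
  rw [← mul_assoc (ENNReal.ofReal 2), h5]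
  ring

lemma lintegral_sq_div_max_le {ρ : ℝ → ℝ≥0∞} (hρ : Measurable ρ) (a : ℝ) :
    ∫⁻ s in Ioi (0 : ℝ), ENNReal.ofReal (s ^ 2 / max a s) * ρ s ≤
      ∫⁻ s in Ioi (0 : ℝ), ENNReal.ofReal s * ρ s := by
  refine setLIntegral_mono (by fun_prop) fun s hs => ?_
  have hs : 0 < s := hs
  gcongr
  rw [div_le_iff₀ (lt_max_of_lt_right hs), sq]
  gcongr
  exact le_max_right _ _

lemma newtonPotential_le {ρ : ℝ → ℝ≥0∞} (hρ : Measurable ρ) (x : EuclideanSpace ℝ (Fin 3)) :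
    newtonPotential ρ x ≤
      ENNReal.ofReal (4 * π) * ∫⁻ s in Ioi (0 : ℝ), ENNReal.ofReal s * ρ s := by
  rw [newtonPotential_eq hρ]
  gcongr _ * ?_
  exact lintegral_sq_div_max_le hρ ‖x‖

lemma newtonPotential_lt {ρ : ℝ → ℝ≥0∞} (hρ : Measurable ρ) (hρ0 : ∀ s, 0 < ρ s)
    (hρ_top : ∀ s, ρ s ≠ ∞) (hfin : ∫⁻ s in Ioi (0 : ℝ), ENNReal.ofReal s * ρ s ≠ ∞)
    {x y : EuclideanSpace ℝ (Fin 3)} (hxy : ‖x‖ < ‖y‖) :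
    newtonPotential ρ y < newtonPotential ρ x := by
  have hlt : ∀ s, 0 < s → s < ‖y‖ → s ^ 2 / max ‖y‖ s < s ^ 2 / max ‖x‖ s := fun s hs hsy => by
    have : max ‖x‖ s < max ‖y‖ s := by
      rw [max_eq_left hsy.le]
      exact max_lt hxy hsy
    have := lt_max_of_lt_right (b := ‖x‖) hs
    gcongr
  rw [newtonPotential_eq hρ, newtonPotential_eq hρ]
  refine (ENNReal.mul_lt_mul_iff_right (by simp [pi_pos]) ENNReal.ofReal_ne_top).2
    (lintegral_strict_mono_of_ae_le_of_ae_lt_on (s := Ioo 0 ‖y‖) (by fun_prop)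
    (ne_top_of_le_ne_top hfin (lintegral_sq_div_max_le hρ ‖y‖)) ?_ ?_ (.of_forall ?_))
  · refine (ae_restrict_iff' measurableSet_Ioi).2 (.of_forall fun s hs => ?_)
    have hs : 0 < s := hs
    have := lt_max_of_lt_right (b := ‖x‖) hs
    dsimp only
    gcongr
  · rw [Measure.restrict_apply measurableSet_Ioo, inter_eq_left.2 Ioo_subset_Ioi_self]
    rw [Real.volume_Ioo, sub_zero]
    exact (ENNReal.ofReal_pos.2 ((norm_nonneg x).trans_lt hxy)).ne'
  · rintro s ⟨hs, hsy⟩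
    refine (ENNReal.mul_lt_mul_iff_left (hρ0 s).ne' (hρ_top s)).2 ?_
    exact (ENNReal.ofReal_lt_ofReal_iff (div_pos (pow_pos hs 2) (lt_max_of_lt_right hs))).2
      (hlt s hs hsy)

lemma newtonPotential_pos {ρ : ℝ → ℝ≥0∞} (hρ : Measurable ρ) (hρ0 : ∀ s, 0 < ρ s)
    (hρ_top : ∀ s, ρ s ≠ ∞) (hfin : ∫⁻ s in Ioi (0 : ℝ), ENNReal.ofReal s * ρ s ≠ ∞)
    (x : EuclideanSpace ℝ (Fin 3)) : 0 < newtonPotential ρ x := by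
  obtain ⟨y, hy⟩ := NormedSpace.exists_lt_norm ℝ (EuclideanSpace ℝ (Fin 3)) ‖x‖
  exact zero_le.trans_lt (newtonPotential_lt hρ hρ0 hρ_top hfin hy)

end Newton

section Representation

variable {E : Type*} [NormedAddCommGroup E] [InnerProductSpace ℝ E] [MeasurableSpace E]
  [BorelSpace E] [FiniteDimensional ℝ E]

lemma charFun_withDensity_ofReal {f : E → ℝ} (hf : Measurable f) (hf0 : ∀ x, 0 ≤ f x) (t : E) :
    charFun (volume.withDensity fun x => ENNReal.ofReal (f x)) t =
      𝓕 (fun x => (f x : ℂ)) (-(2 * π)⁻¹ • t) := by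
  rw [charFun_apply, integral_withDensity_eq_integral_toReal_smul hf.ennreal_ofReal
    (.of_forall fun x => ENNReal.ofReal_lt_top), Real.fourier_eq']
  refine integral_congr_ae (.of_forall fun x => ?_)
  have h : -2 * π * ⟪x, -(2 * π)⁻¹ • t⟫ = ⟪x, t⟫ := by
    rw [real_inner_smul_right]
    field_simp
  simp only [h, ENNReal.toReal_ofReal (hf0 x), Complex.real_smul, smul_eq_mul]
  ring

lemma ae_eq_lconvolution_resolventKernel {f g : E → ℝ} (hf : Measurable f) (hg : Measurable g)
    (hf0 : ∀ x, 0 ≤ f x) (hg0 : ∀ x, 0 ≤ g x) (hfi : Integrable f) (hgi : Integrable g)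
    (h : ∀ ξ, 𝓕 (fun x => (f x : ℂ)) ξ = (1 + 2 * π * ‖ξ‖ : ℝ) * 𝓕 (fun x => (g x : ℂ)) ξ) :
    (fun x => ENNReal.ofReal (g x)) =ᵐ[volume]
      (fun x => ENNReal.ofReal (f x)) ⋆ₗ resolventKernel := by
  have := isFiniteMeasure_withDensity_ofReal hfi.2
  have := isFiniteMeasure_withDensity_ofReal hgi.2
  have hk : Measurable (resolventKernel : E → ℝ≥0∞) := measurable_resolventKernel
  rw [← withDensity_eq_iff hg.ennreal_ofReal.aemeasurable
    (measurable_lconvolution volume hf.ennreal_ofReal hk).aemeasurable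
    hgi.lintegral_lt_top.ne, ← conv_withDensity_eq_lconvolution hf.ennreal_ofReal hk]
  refine Measure.ext_of_charFun (funext fun t => ?_)
  rw [charFun_conv, charFun_withDensity_ofReal hf hf0, charFun_withDensity_ofReal hg hg0, h,
    charFun_resolventKernel]
  have ht : 2 * π * ‖-(2 * π)⁻¹ • t‖ = ‖t‖ := by
    rw [norm_smul, norm_neg, norm_inv, norm_of_nonneg (by positivity)]
    field_simp
  have hne : (1 + ‖t‖ : ℂ) ≠ 0 := by
    exact_mod_cast (by positivity : (1 + ‖t‖ : ℝ) ≠ 0)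
  rw [ht]
  push_cast
  field_simp

end Representation

section GroundState

lemma lintegral_mul_sq_ne_top {f : ℝ → ℝ} (hf0 : ∀ s, 0 ≤ f s) {C : ℝ}
    (hfC : ∀ s, f s ≤ C * ((1 + s ^ 2) ^ (2 : ℝ))⁻¹) :
    ∫⁻ s in Ioi (0 : ℝ), ENNReal.ofReal s * ENNReal.ofReal (f s ^ 2) ≠ ∞ := by
  have hint : Integrable fun s : ℝ => C ^ 2 * (1 + s ^ 2)⁻¹ := integrable_inv_one_add_sq.const_mul _
  refine ne_top_of_le_ne_top hint.lintegral_lt_top.ne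
    ((setLIntegral_mono (by fun_prop) fun s hs => ?_).trans (setLIntegral_le_lintegral _ _))
  have hs : 0 < s := hs
  rw [← ENNReal.ofReal_mul hs.le]
  refine ENNReal.ofReal_le_ofReal ?_
  have h1 : f s ^ 2 ≤ (C * ((1 + s ^ 2) ^ (2 : ℝ))⁻¹) ^ 2 := pow_le_pow_left₀ (hf0 s) (hfC s) 2
  rw [rpow_two] at h1
  have h2 : s ≤ (1 + s ^ 2) ^ 3 := by nlinarith [sq_nonneg (s - 1), sq_nonneg (s ^ 2), pow_pos hs 6]
  calc s * f s ^ 2 ≤ (1 + s ^ 2) ^ 3 * (C * ((1 + s ^ 2) ^ 2)⁻¹) ^ 2 := by gcongr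
    _ = _ := by field_simp

variable {Q : EuclideanSpace ℝ (Fin 3) → ℝ}

lemma integrable_of_decay (hQcont : Continuous Q) (hQ0 : ∀ x, 0 ≤ Q x) {C : ℝ}
    (hQdecay : ∀ x, Q x ≤ C * ((1 + ‖x‖ ^ 2) ^ (2 : ℝ))⁻¹) : Integrable Q := by
  have h : Integrable fun x : EuclideanSpace ℝ (Fin 3) => (1 + ‖x‖ ^ 2) ^ (-(4 : ℝ) / 2) :=
    integrable_rpow_neg_one_add_norm_sq (by rw [finrank_euclideanSpace_fin]; norm_num)
  refine (h.const_mul C).mono' hQcont.aestronglyMeasurable (.of_forall fun x => ?_)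
  rw [norm_of_nonneg (hQ0 x), show -(4 : ℝ) / 2 = -2 by norm_num, rpow_neg (by positivity)]
  exact hQdecay x

lemma ofReal_integral_eq_newtonPotential {ρ : ℝ → ℝ} (hρ : Continuous ρ) (hρ0 : ∀ s, 0 ≤ ρ s)
    {x : EuclideanSpace ℝ (Fin 3)} (hfin : newtonPotential (fun s => ENNReal.ofReal (ρ s)) x ≠ ∞) :
    ENNReal.ofReal (∫ y, ‖x - y‖⁻¹ * ρ ‖y‖) =
      newtonPotential (fun s => ENNReal.ofReal (ρ s)) x := by
  have h : newtonPotential (fun s => ENNReal.ofReal (ρ s)) x =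
      ∫⁻ y, ENNReal.ofReal (‖x - y‖⁻¹ * ρ ‖y‖) :=
    lintegral_congr fun y => (ENNReal.ofReal_mul (by positivity)).symm
  rw [integral_eq_lintegral_of_nonneg_ae
    (.of_forall fun y => mul_nonneg (by positivity) (hρ0 _))
    (Measurable.aestronglyMeasurable (by fun_prop)), ← h, ENNReal.ofReal_toReal hfin]

lemma fourier_ofReal_eq {f g : EuclideanSpace ℝ (Fin 3) → ℝ} (hf : Integrable f)
    (hg : Integrable g) {h : EuclideanSpace ℝ (Fin 3) → ℝ} (hfg : ∀ x, h x + g x = f x)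
    (hh : sqrtLapl g h) (ξ : EuclideanSpace ℝ (Fin 3)) :
    𝓕 (fun x => (f x : ℂ)) ξ = (1 + 2 * π * ‖ξ‖ : ℝ) * 𝓕 (fun x => (g x : ℂ)) ξ := by
  have hi : ∀ {k : EuclideanSpace ℝ (Fin 3) → ℝ}, Integrable k → Integrable fun x =>
      Complex.exp (↑(-2 * π * ⟪x, ξ⟫) * Complex.I) • (k x : ℂ) := fun hk => by
    have hexp : Continuous fun x : EuclideanSpace ℝ (Fin 3) =>
        Complex.exp (↑(-2 * π * ⟪x, ξ⟫) * Complex.I) := by fun_prop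
    exact (Integrable.ofReal (𝕜 := ℂ) hk).bdd_mul (c := 1) hexp.aestronglyMeasurable
      (.of_forall fun x => (Complex.norm_exp_ofReal_mul_I _).le)
  have hh' : Integrable h := by
    have := hf.sub hg
    refine this.congr (.of_forall fun x => ?_)
    simp [← hfg]
  have key : 𝓕 (fun x => (f x : ℂ)) ξ =
      𝓕 (fun x => (h x : ℂ)) ξ + 𝓕 (fun x => (g x : ℂ)) ξ := by
    rw [Real.fourier_eq', Real.fourier_eq', Real.fourier_eq', ← integral_add (hi hh') (hi hg)]
    refine integral_congr_ae (.of_forall fun x => ?_)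
    simp only [← hfg, Complex.ofReal_add, smul_add]
  rw [key, hh ξ]
  push_cast
  ring

end GroundState

/-- If the ground state fixed point `Q` is radial with positive, radial, strictly
decreasing Fourier transform, then `Q(|x|)` is strictly decreasing in `|x|`. -/
theorem Q_strictly_decreasing
    (Q gQ : EuclideanSpace ℝ (Fin 3) → ℝ) (C : ℝ)
    (hQcont : Continuous Q) (hQpos : ∀ x, 0 < Q x)
    (hQdecay : ∀ x, Q x ≤ C * ((1 + ‖x‖ ^ 2) ^ (2:ℝ))⁻¹)
    (hgQ : sqrtLapl Q gQ)
    (hfix : ∀ x, gQ x + Q x = (∫ y, ‖x - y‖⁻¹ * (Q y) ^ 2) * Q x)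
    (hQrad : ∀ x y : EuclideanSpace ℝ (Fin 3), ‖x‖ = ‖y‖ → Q x = Q y)
    (hhatpos : ∀ ξ, (𝓕 (fun x => (Q x : ℂ)) ξ).im = 0 ∧
      0 < (𝓕 (fun x => (Q x : ℂ)) ξ).re)
    (hhatrad : ∀ ξ ξ' : EuclideanSpace ℝ (Fin 3), ‖ξ‖ = ‖ξ'‖ →
      𝓕 (fun x => (Q x : ℂ)) ξ = 𝓕 (fun x => (Q x : ℂ)) ξ')
    (hhatdec : ∀ ξ ξ' : EuclideanSpace ℝ (Fin 3), ‖ξ‖ < ‖ξ'‖ →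
      (𝓕 (fun x => (Q x : ℂ)) ξ').re < (𝓕 (fun x => (Q x : ℂ)) ξ).re) :
    ∀ x x' : EuclideanSpace ℝ (Fin 3), ‖x‖ < ‖x'‖ → Q x' < Q x := by
  have hQ0 : ∀ x, 0 ≤ Q x := fun x => (hQpos x).le
  have hC : 0 ≤ C := by simpa using (hQ0 0).trans (hQdecay 0)
  set e : EuclideanSpace ℝ (Fin 3) := EuclideanSpace.single 0 1
  have he : ‖e‖ = 1 := by simp [e]
  have hQi := integrable_of_decay hQcont hQ0 hQdecay
  have hQC : ∀ x, Q x ≤ C := fun x => (hQdecay x).trans <| mul_le_of_le_one_right hC <|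
    inv_le_one_of_one_le₀ (one_le_rpow (by nlinarith [sq_nonneg ‖x‖]) zero_le_two)
  have hprof : ∀ y, Q y = Q (‖y‖ • e) := fun y => hQrad _ _ (by simp [norm_smul, he])
  set ρ : ℝ → ℝ := fun s => Q (s • e) ^ 2 with hρdef
  have hρc : Continuous ρ := by fun_prop
  have hρ : Measurable fun s => ENNReal.ofReal (ρ s) := hρc.measurable.ennreal_ofReal
  have hρ0 : ∀ s, 0 < ENNReal.ofReal (ρ s) := fun s => ENNReal.ofReal_pos.2 (pow_pos (hQpos _) 2)
  have hfin : ∫⁻ s in Ioi (0 : ℝ), ENNReal.ofReal s * ENNReal.ofReal (ρ s) ≠ ∞ :=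
    lintegral_mul_sq_ne_top (fun s => hQ0 (s • e)) (C := C) fun s => by
      simpa [norm_smul, he] using hQdecay (s • e)
  set M := ENNReal.ofReal (4 * π) * ∫⁻ s in Ioi (0 : ℝ), ENNReal.ofReal s * ENNReal.ofReal (ρ s)
  have hM : M ≠ ∞ := ENNReal.mul_ne_top ENNReal.ofReal_ne_top hfin
  set v := newtonPotential fun s => ENNReal.ofReal (ρ s) with hvdef
  have hvM : ∀ x, v x ≤ M := newtonPotential_le hρ
  have hv : Measurable v := measurable_newtonPotential hρ
  have hv_top : ∀ x, v x ≠ ∞ := fun x => ne_top_of_le_ne_top hM (hvM x)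
  have hV : ∀ x, ENNReal.ofReal (∫ y, ‖x - y‖⁻¹ * Q y ^ 2) = v x := fun x => by
    rw [hvdef, ← ofReal_integral_eq_newtonPotential hρc (fun s => sq_nonneg _) (hv_top x)]
    simp only [hρdef, ← hprof]
  have hV' : ∀ x, ∫ y, ‖x - y‖⁻¹ * Q y ^ 2 = (v x).toReal := fun x => by
    rw [← hV, ENNReal.toReal_ofReal (integral_nonneg fun y => by positivity)]
  have hFi : Integrable fun x => (v x).toReal * Q x :=
    hQi.bdd_mul (c := M.toReal) hv.ennreal_toReal.aestronglyMeasurable (.of_forall fun x => by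
      rw [norm_of_nonneg ENNReal.toReal_nonneg]
      exact ENNReal.toReal_mono hM (hvM x))
  have hrep := ae_eq_lconvolution_resolventKernel (f := fun x => (v x).toReal * Q x)
    (hv.ennreal_toReal.mul hQcont.measurable)
    hQcont.measurable (fun x => mul_nonneg ENNReal.toReal_nonneg (hQ0 x)) hQ0 hFi hQi
    (fourier_ofReal_eq hFi hQi (fun x => by rw [hfix, hV']) hgQ)
  have hvq : (fun x => ENNReal.ofReal ((v x).toReal * Q x)) =
      v * fun x => ENNReal.ofReal (Q x) := funext fun x => by
    rw [ENNReal.ofReal_mul ENNReal.toReal_nonneg, ENNReal.ofReal_toReal (hv_top x), Pi.mul_apply]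
  rw [hvq] at hrep
  intro x x' hxx'
  refine lt_of_ae_lt_hyperplaneReflection he hQcont hQrad (fun l hl => ?_) hxx'
  filter_upwards [ae_lt_hyperplaneReflection he hl hQcont.measurable.ennreal_ofReal hv hM
    ENNReal.ofReal_ne_top (fun x => ENNReal.ofReal_le_ofReal (hQC x))
    (fun x => ENNReal.ofReal_pos.2 (hQpos x)) hQi.lintegral_lt_top.ne hvM
    (newtonPotential_pos hρ hρ0 (fun _ => ENNReal.ofReal_ne_top) hfin)
    (fun x y => newtonPotential_lt hρ hρ0 (fun _ => ENNReal.ofReal_ne_top) hfin) hrep]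
    with y hy hly
  exact (ENNReal.ofReal_lt_ofReal_iff (hQpos _)).1 (hy hly)
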